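/- Fix z ∈ ℂ. Let f, w : [0,∞) → ℂ² be solutions of Ju' = zHu on [0,∞), let f̃, w̃ : [0,∞) → ℂ² be solutions of Ju' = z̄Hu on [0,∞), and assume f(x) w̃(x)* − w(x) f̃(x)* = J for all x ≥ 0. Let h : [0,∞) → ℂ² be measurable with ∫₀^∞ |w̃(t)* H(t) h(t)| dt < ∞ on every compact set and ∫₀^∞ |f̃(t)* H(t) h(t)| dt < ∞, and define y(x) = f(x) ∫₀ˣ w̃(t)* H(t) h(t) dt + w(x) ∫ₓ^∞ f̃(t)* H(t) h(t) dt. Then y is locally absolutely continuous and solves J y' = z H y − H h a.e. on [0,∞); equivalently y(x) = y(0) + ∫₀ˣ (−J)( z H(t) y(t) − H(t) h(t) ) dt for all x ≥ 0. -/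

import Mathlib

open MeasureTheory Matrix Set
open scoped ComplexOrder

noncomputable section

/-- The matrix `J = [[0,-1],[1,0]]`. -/
def Jmat : Matrix (Fin 2) (Fin 2) ℂ := !![0, -1; 1, 0]

/-- `u` is a solution of the canonical system `J u' = z H u` on `[0,∞)`:
`u(x) = u(0) − z ∫₀ˣ J H(t) u(t) dt` for all `x ≥ 0`. -/
def IsSolution (H : ℝ → Matrix (Fin 2) (Fin 2) ℂ) (z : ℂ) (u : ℝ → Fin 2 → ℂ) : Prop :=
  ∀ x ≥ (0:ℝ), u x = u 0 - z • ∫ t in (0:ℝ)..x, (Jmat * H t).mulVec (u t)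

/-- `u` lies in `L²(H, ℝ₊)`: `∫₀^∞ u(x)* H(x) u(x) dx < ∞`. -/
def InL2 (H : ℝ → Matrix (Fin 2) (Fin 2) ℂ) (u : ℝ → Fin 2 → ℂ) : Prop :=
  IntegrableOn (fun x => star (u x) ⬝ᵥ (H x).mulVec (u x)) (Set.Ioi 0)

section helpers
open Filter Topology

lemma ac_of_dist_le {X Y : Type*} [PseudoMetricSpace X] [PseudoMetricSpace Y]
    {F : ℝ → X} {G : ℝ → Y} {a b : ℝ}
    (hF : AbsolutelyContinuousOnInterval F a b)
    (h : ∀ x ∈ uIcc a b, ∀ y ∈ uIcc a b, dist (G x) (G y) ≤ dist (F x) (F y)) :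
    AbsolutelyContinuousOnInterval G a b := by
  refine squeeze_zero' ?_ ?_ hF
  · filter_upwards with E
    exact Finset.sum_nonneg (fun _ _ ↦ dist_nonneg)
  · have : ∀ᶠ (E : ℕ × (ℕ → ℝ × ℝ)) in AbsolutelyContinuousOnInterval.totalLengthFilter ⊓
        𝓟 (AbsolutelyContinuousOnInterval.disjWithin a b),
        E ∈ AbsolutelyContinuousOnInterval.disjWithin a b :=
      eventually_inf_principal.mpr (by simp)
    filter_upwards [this] with E hE
    refine Finset.sum_le_sum fun i hi => ?_
    exact h _ (hE.1 i hi).1 _ (hE.1 i hi).2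

lemma ac_integral {E : Type*} [NormedAddCommGroup E] [NormedSpace ℝ E]
    {f : ℝ → E} {a b : ℝ} (h : IntervalIntegrable f volume a b) (c : E) :
    AbsolutelyContinuousOnInterval (fun x ↦ c + ∫ v in a..x, f v) a b := by
  refine ac_of_dist_le
    (h.norm.absolutelyContinuousOnInterval_intervalIntegral (c := a) left_mem_uIcc) ?_
  intro x hx y hy
  have h1 : ∀ s ∈ uIcc a b, IntervalIntegrable f volume a s := fun s hs =>
    h.mono_set (uIcc_subset_uIcc left_mem_uIcc hs)
  rw [dist_add_left, dist_eq_norm, Real.dist_eq,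
    intervalIntegral.integral_interval_sub_left (h1 x hx) (h1 y hy),
    intervalIntegral.integral_interval_sub_left (h1 x hx).norm (h1 y hy).norm]
  exact intervalIntegral.norm_integral_le_abs_integral_norm

lemma prod_rule {E : Type*} [NormedAddCommGroup E] [NormedSpace ℂ E] [CompleteSpace E]
    {p a : ℝ → ℂ} {F f : ℝ → E} {T : ℝ} (hT : 0 ≤ T)
    (hp : IntervalIntegrable p volume 0 T) (hF : IntervalIntegrable F volume 0 T)
    (ha : ∀ x ∈ Icc 0 T, a x = a 0 + ∫ t in (0:ℝ)..x, p t)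
    (hf : ∀ x ∈ Icc 0 T, f x = f 0 + ∫ t in (0:ℝ)..x, F t) :
    IntervalIntegrable (fun t => p t • f t + a t • F t) volume 0 T ∧
    a T • f T = a 0 • f 0 + ∫ t in (0:ℝ)..T, (p t • f t + a t • F t) := by
  have hac := ac_integral hp (a 0)
  have hfc := ac_integral hF (f 0)
  set a' : ℝ → ℂ := fun x => a 0 + ∫ t in (0:ℝ)..x, p t with ha'
  set f' : ℝ → E := fun x => f 0 + ∫ t in (0:ℝ)..x, F t with hf'
  have hcong : ∀ t ∈ uIcc 0 T, p t • f' t + a' t • F t = p t • f t + a t • F t := by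
    intro t ht
    rw [uIcc_of_le hT] at ht
    rw [ha t ht, hf t ht]
  have hi' : IntervalIntegrable (fun t => p t • f' t + a' t • F t) volume 0 T :=
    (hp.smul_continuousOn hfc.continuousOn).add (hF.continuousOn_smul hac.continuousOn)
  have hi := hi'.congr (g := fun t => p t • f t + a t • F t)
    (fun t ht => hcong t (uIoc_subset_uIcc ht))
  refine ⟨hi, ?_⟩
  rw [← intervalIntegral.integral_congr hcong]
  have hG : AbsolutelyContinuousOnInterval
      (fun x => a' x • f' x - (0 + ∫ t in (0:ℝ)..x, (p t • f' t + a' t • F t))) 0 T :=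
    (hac.fun_smul hfc).fun_sub (ac_integral hi' 0)
  obtain ⟨C, hC⟩ := hG.const_of_ae_hasDerivAt_zero (by
    filter_upwards [hp.ae_hasDerivAt_integral, hF.ae_hasDerivAt_integral,
      hi'.ae_hasDerivAt_integral] with x h1 h2 h3 hx
    have e1 : HasDerivAt a' (p x) x := (h1 hx 0 left_mem_uIcc).const_add _
    have e2 : HasDerivAt f' (F x) x := (h2 hx 0 left_mem_uIcc).const_add _
    have e3 := (h3 hx 0 left_mem_uIcc).const_add (0:E)
    have e4 := (e1.fun_smul e2).fun_sub e3
    convert! e4 using 1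
    abel)
  have c0 := hC 0 left_mem_uIcc
  have cT := hC T right_mem_uIcc
  rw [← c0] at cT
  have e0 : a' 0 = a 0 := by simp [ha']
  have e0' : f' 0 = f 0 := by simp [hf']
  have eT : a' T = a T := (ha T ⟨hT, le_rfl⟩).symm
  have eT' : f' T = f T := (hf T ⟨hT, le_rfl⟩).symm
  simp only [eT, eT', e0, e0', intervalIntegral.integral_same, zero_add, sub_zero] at cT
  rw [← cT]; abel

lemma mulVec_int {A : ℝ → Matrix (Fin 2) (Fin 2) ℂ} {u : ℝ → Fin 2 → ℂ} {s : Set ℝ} {M : ℝ}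
    (hs : MeasurableSet s) (hA : ∀ i j, IntegrableOn (fun t => A t i j) s)
    (hu : ContinuousOn u s) (hM : ∀ x ∈ s, ‖u x‖ ≤ M) :
    IntegrableOn (fun t => (A t).mulVec (u t)) s := by
  refine Integrable.of_eval fun i => ?_
  simp only [Matrix.mulVec, dotProduct]
  refine integrable_finsetSum _ fun j _ => ?_
  refine Integrable.mul_bdd (c := M) (hA i j) ?_ ?_
  · exact (((continuous_apply j).comp_continuousOn hu)).aestronglyMeasurable hs
  · filter_upwards [ae_restrict_mem hs] with x hx
    exact (norm_le_pi_norm (u x) j).trans (hM x hx)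

lemma mulVec_bd (A : Matrix (Fin 2) (Fin 2) ℂ) (v : Fin 2 → ℂ) :
    ‖A.mulVec v‖ ≤ (∑ i, ∑ j, ‖A i j‖) * ‖v‖ := by
  refine (pi_norm_le_iff_of_nonneg (by positivity)).2 fun i => ?_
  calc ‖A.mulVec v i‖ ≤ ∑ j, ‖A i j * v j‖ := by
        simp only [Matrix.mulVec, dotProduct]
        exact norm_sum_le _ _
    _ ≤ ∑ j, ‖A i j‖ * ‖v‖ := by
        refine Finset.sum_le_sum fun j _ => ?_
        rw [norm_mul]
        gcongr
        exact norm_le_pi_norm v j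
    _ = (∑ j, ‖A i j‖) * ‖v‖ := by rw [Finset.sum_mul]
    _ ≤ _ := by
        refine mul_le_mul_of_nonneg_right ?_ (norm_nonneg _)
        exact Finset.single_le_sum (f := fun i => ∑ j, ‖A i j‖)
          (fun i _ => by positivity) (Finset.mem_univ i)

lemma sol_int {A : ℝ → Matrix (Fin 2) (Fin 2) ℂ} {u : ℝ → Fin 2 → ℂ} {T : ℝ} (hT : 0 ≤ T)
    (hA : ∀ i j, IntegrableOn (fun t => A t i j) (Icc 0 T))
    (hu : ∀ x ∈ Icc 0 T, u x = u 0 + ∫ t in (0:ℝ)..x, (A t).mulVec (u t)) :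
    IntervalIntegrable (fun t => (A t).mulVec (u t)) volume 0 T := by
  by_contra hn
  set g : ℝ → Fin 2 → ℂ := fun t => (A t).mulVec (u t) with hg
  set φ : ℝ → ℝ := fun t => ∑ i, ∑ j, ‖A t i j‖ with hφ
  have hφ0 : ∀ t, 0 ≤ φ t := fun t => by positivity
  have hφi : IntervalIntegrable φ volume 0 T := by
    rw [intervalIntegrable_iff_integrableOn_Icc_of_le hT]
    exact integrable_finsetSum _ fun i _ => integrable_finsetSum _ fun j _ => (hA i j).norm
  set S : Set ℝ := {x | x ∈ Icc 0 T ∧ IntervalIntegrable g volume 0 x} with hS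
  have h0S : (0:ℝ) ∈ S := ⟨⟨le_rfl, hT⟩, IntervalIntegrable.refl⟩
  have hbdd : BddAbove S := ⟨T, fun x hx => hx.1.2⟩
  set X := sSup S with hX
  have hX0 : 0 ≤ X := le_csSup hbdd h0S
  have hXT : X ≤ T := csSup_le ⟨0, h0S⟩ fun x hx => hx.1.2
  have hlt : ∀ x, 0 ≤ x → x < X → IntervalIntegrable g volume 0 x := by
    intro x hx0 hx
    obtain ⟨s, hs, hxs⟩ := exists_lt_of_lt_csSup ⟨0, h0S⟩ hx
    refine hs.2.mono_set ?_
    rw [uIcc_of_le hx0, uIcc_of_le hs.1.1]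
    exact Icc_subset_Icc_right hxs.le
  have hgt : ∀ x, X < x → x ≤ T → u x = u 0 := by
    intro x hx hxT
    rw [hu x ⟨hX0.trans hx.le, hxT⟩, intervalIntegral.integral_undef, add_zero]
    intro hc
    exact absurd (le_csSup hbdd (show x ∈ S from ⟨⟨hX0.trans hx.le, hxT⟩, hc⟩)) (not_le.2 hx)
  have h2 : IntervalIntegrable g volume X T := by
    rw [intervalIntegrable_iff_integrableOn_Ioc_of_le hXT]
    have := mulVec_int (A := A) (u := fun _ => u 0) (s := Ioc X T) (M := ‖u 0‖) measurableSet_Ioc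
      (fun i j => (hA i j).mono_set (fun x hx => ⟨hX0.trans hx.1.le, hx.2⟩))
      continuousOn_const (fun _ _ => le_rfl)
    refine this.congr_fun (fun t ht => ?_) measurableSet_Ioc
    simp only [hg, hgt t ht.1 ht.2]
  have hc : ∀ x, 0 ≤ x → x < X → ContinuousOn u (Icc 0 x) := by
    intro x hx0 hx
    have := (ac_integral (hlt x hx0 hx) (u 0)).continuousOn
    rw [uIcc_of_le hx0] at this
    exact this.congr fun t ht => hu t ⟨ht.1, ht.2.trans (hx.le.trans hXT)⟩
  have h1 : IntervalIntegrable g volume 0 X := by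
    rcases hX0.eq_or_lt with h | hXpos
    · rw [← h]
    have hcX : ContinuousOn u (Ico 0 X) := by
      intro x hx
      have hm : (x + X) / 2 < X := by linarith [hx.2]
      have hm' : x < (x + X) / 2 := by linarith [hx.2]
      refine (hc ((x + X) / 2) (by linarith [hx.1]) hm x ⟨hx.1, hm'.le⟩).mono_of_mem_nhdsWithin ?_
      filter_upwards [self_mem_nhdsWithin, mem_nhdsWithin_of_mem_nhds (Iio_mem_nhds hm')]
        with t ht ht'
      exact ⟨ht.1, le_of_lt ht'⟩
    set ψ : ℝ → ℝ := fun x => 0 + ∫ t in (0:ℝ)..x, φ t with hψ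
    have hψc : ContinuousOn ψ (Icc 0 T) := by
      have := (ac_integral hφi 0).continuousOn
      rwa [uIcc_of_le hT] at this
    have hφab : ∀ a ∈ Icc 0 T, ∀ b ∈ Icc 0 T, IntervalIntegrable φ volume a b := by
      intro a ha b hb
      refine hφi.mono_set (uIcc_subset_uIcc ?_ ?_) <;> rwa [uIcc_of_le hT]
    have hψd : ∀ a ∈ Icc 0 T, ∀ b ∈ Icc 0 T, ψ b - ψ a = ∫ t in a..b, φ t := by
      intro a ha b hb
      have z0 : (0:ℝ) ∈ Icc 0 T := ⟨le_rfl, hT⟩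
      simp only [hψ, zero_add]
      exact intervalIntegral.integral_interval_sub_left (hφab 0 z0 b hb) (hφab 0 z0 a ha)
    have hψt : Tendsto ψ (𝓝[<] X) (𝓝 (ψ X)) := by
      refine (hψc X ⟨hX0, hXT⟩).mono_left ?_
      refine nhdsWithin_le_iff.2 ?_
      filter_upwards [Ioo_mem_nhdsLT hXpos] with t ht
      exact ⟨ht.1.le, ht.2.le.trans hXT⟩
    obtain ⟨a, ha1, ha2⟩ := ((hψt.eventually (lt_mem_nhds
      (show ψ X - 1/2 < ψ X by linarith))).and (Ioo_mem_nhdsLT hXpos)).exists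
    have haT : a ∈ Icc 0 T := ⟨ha2.1.le, ha2.2.le.trans hXT⟩
    have hb : ∀ x, a ≤ x → x < X → ‖u x‖ ≤ 2 * ‖u a‖ := by
      intro x hax hx
      have hx0 : 0 ≤ x := ha2.1.le.trans hax
      obtain ⟨s, hs, hmax⟩ := isCompact_Icc.exists_isMaxOn (nonempty_Icc.2 hax)
        ((hc x hx0 hx).mono (Icc_subset_Icc_left ha2.1.le)).norm
      have hsX : s < X := hs.2.trans_lt hx
      have hsT : s ∈ Icc 0 T := ⟨ha2.1.le.trans hs.1, hsX.le.trans hXT⟩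
      have e1 : u s - u a = ∫ t in a..s, g t := by
        rw [hu s hsT, hu a haT, add_sub_add_left_eq_sub]
        exact intervalIntegral.integral_interval_sub_left
          (hlt s hsT.1 hsX) (hlt a haT.1 ha2.2)
      have e2 : ‖∫ t in a..s, g t‖ ≤ ∫ t in a..s, φ t * ‖u s‖ := by
        refine intervalIntegral.norm_integral_le_of_norm_le hs.1 ?_
          ((hφab a haT s hsT).mul_const _)
        filter_upwards with t ht
        refine (mulVec_bd (A t) (u t)).trans ?_
        exact mul_le_mul_of_nonneg_left (hmax ⟨ht.1.le, ht.2.trans hs.2⟩) (hφ0 t)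
      rw [intervalIntegral.integral_mul_const, ← hψd a haT s hsT] at e2
      have e3 : 0 ≤ ψ X - ψ s := by
        rw [hψd s hsT X ⟨hX0, hXT⟩]
        exact intervalIntegral.integral_nonneg hsX.le fun t _ => hφ0 t
      have e4 : (ψ s - ψ a) * ‖u s‖ ≤ 1/2 * ‖u s‖ :=
        mul_le_mul_of_nonneg_right (by linarith) (norm_nonneg _)
      have e5 : ‖u s‖ ≤ ‖u a‖ + ‖u s - u a‖ := by
        have := norm_add_le (u a) (u s - u a)
        rwa [add_sub_cancel] at this
      rw [e1] at e5
      have e6 : ‖u x‖ ≤ ‖u s‖ := hmax ⟨hax, le_rfl⟩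
      linarith
    have i2 : IntervalIntegrable g volume a X := by
      rw [intervalIntegrable_iff_integrableOn_Ico_of_le ha2.2.le]
      exact mulVec_int measurableSet_Ico
        (fun i j => (hA i j).mono_set (fun x hx => ⟨haT.1.trans hx.1, hx.2.le.trans hXT⟩))
        (hcX.mono (Ico_subset_Ico_left haT.1)) (fun x hx => hb x hx.1 hx.2)
    exact (hlt a haT.1 ha2.2).trans i2
  exact hn (h1.trans h2)

end helpers

/-- Green's function lemma on `[0,∞)`: with `f, w` solutions for `z`, `f̃, w̃` solutions for
`z̄` satisfying `f w̃* − w f̃* = J`, the function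
`y(x) = f(x)∫₀ˣ w̃*Hh + w(x)∫ₓ^∞ f̃*Hh` solves `Jy' = zHy − Hh` on `[0,∞)`. -/
theorem statement7 (H : ℝ → Matrix (Fin 2) (Fin 2) ℂ)
    (hmeas : ∀ i j, Measurable fun x => H x i j)
    (hpsd : ∀ᵐ x ∂(volume.restrict (Set.Ici (0:ℝ))), (H x).PosSemidef)
    (hloc : ∀ i j, LocallyIntegrableOn (fun x => H x i j) (Set.Ici (0:ℝ)))
    (z : ℂ) (f w ft wt : ℝ → Fin 2 → ℂ)
    (hf : IsSolution H z f) (hw : IsSolution H z w)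
    (hft : IsSolution H (starRingEnd ℂ z) ft)
    (hwt : IsSolution H (starRingEnd ℂ z) wt)
    (hJ : ∀ x ≥ (0:ℝ),
      vecMulVec (f x) (star (wt x)) - vecMulVec (w x) (star (ft x)) = Jmat)
    (h : ℝ → Fin 2 → ℂ) (hhm : Measurable h)
    (hint1 : LocallyIntegrableOn (fun t => star (wt t) ⬝ᵥ (H t).mulVec (h t)) (Set.Ici (0:ℝ)))
    (hint2 : IntegrableOn (fun t => star (ft t) ⬝ᵥ (H t).mulVec (h t)) (Set.Ioi (0:ℝ)))
    (y : ℝ → Fin 2 → ℂ)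
    (hy : ∀ x ≥ (0:ℝ), y x =
      (∫ t in (0:ℝ)..x, star (wt t) ⬝ᵥ (H t).mulVec (h t)) • f x +
      (∫ t in Set.Ioi x, star (ft t) ⬝ᵥ (H t).mulVec (h t)) • w x) :
    ∀ x ≥ (0:ℝ), y x =
      y 0 + ∫ t in (0:ℝ)..x, (-Jmat).mulVec (z • (H t).mulVec (y t) - (H t).mulVec (h t)) := by
  intro x hx
  set A : ℝ → Matrix (Fin 2) (Fin 2) ℂ := fun t => (-z) • (Jmat * H t) with hA
  have hHi : ∀ i j, IntegrableOn (fun t => H t i j) (Icc 0 x) := fun i j =>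
    (hloc i j).integrableOn_compact_subset (fun t ht => ht.1) isCompact_Icc
  have hAi : ∀ i j, IntegrableOn (fun t => A t i j) (Icc 0 x) := by
    intro i j
    simp only [hA, Matrix.smul_apply, Matrix.mul_apply]
    refine Integrable.smul (-z) (integrable_finsetSum _ fun k _ => ?_)
    exact (hHi k j).const_mul _
  have hsol : ∀ u, IsSolution H z u → ∀ s ∈ Icc 0 x,
      u s = u 0 + ∫ t in (0:ℝ)..s, (A t).mulVec (u t) := by
    intro u hu s hs
    rw [hu s hs.1]
    simp only [hA, Matrix.smul_mulVec, intervalIntegral.integral_smul, neg_smul,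
      Matrix.neg_mulVec, intervalIntegral.integral_neg, sub_eq_add_neg]
  set p : ℝ → ℂ := fun t => star (wt t) ⬝ᵥ (H t).mulVec (h t) with hp
  set q : ℝ → ℂ := fun t => star (ft t) ⬝ᵥ (H t).mulVec (h t) with hq
  have hpi : IntervalIntegrable p volume 0 x := by
    rw [intervalIntegrable_iff_integrableOn_Icc_of_le hx]
    exact hint1.integrableOn_compact_subset (fun t ht => ht.1) isCompact_Icc
  have hqi : IntervalIntegrable q volume 0 x := by
    rw [intervalIntegrable_iff_integrableOn_Ioc_of_le hx]
    exact hint2.mono_set fun t ht => ht.1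
  obtain ⟨i1, r1⟩ := prod_rule (a := fun s => ∫ t in (0:ℝ)..s, p t) hx hpi
    (sol_int hx hAi (hsol f hf)) (fun s hs => by simp) (hsol f hf)
  obtain ⟨i2, r2⟩ := prod_rule (p := fun t => - q t) (a := fun s => ∫ t in Set.Ioi s, q t) hx
    hqi.neg (sol_int hx hAi (hsol w hw)) (fun s hs => by
      have := intervalIntegral.integral_interval_add_Ioi hint2
        (hint2.mono_set (Ioi_subset_Ioi hs.1))
      simp only [intervalIntegral.integral_neg]
      rw [← this]
      ring) (hsol w hw)
  rw [hy x hx, hy 0 le_rfl, r1, r2, add_add_add_comm, ← intervalIntegral.integral_add i1 i2]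
  congr 1
  refine intervalIntegral.integral_congr fun t ht => ?_
  rw [uIcc_of_le hx] at ht
  have key : p t • f t - q t • w t = Jmat.mulVec ((H t).mulVec (h t)) := by
    rw [← hJ t ht.1, Matrix.sub_mulVec, Matrix.vecMulVec_mulVec, Matrix.vecMulVec_mulVec]
    simp only [hp, hq, op_smul_eq_smul]
  have key2 : (-Jmat).mulVec (z • (H t).mulVec (y t) - (H t).mulVec (h t))
      = (A t).mulVec (y t) + Jmat.mulVec ((H t).mulVec (h t)) := by
    simp only [hA, Matrix.smul_mulVec, Matrix.neg_mulVec, Matrix.mulVec_sub, Matrix.mulVec_smul,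
      Matrix.mulVec_mulVec, neg_smul, Matrix.neg_mul, smul_neg]
    abel
  beta_reduce
  rw [key2, ← key, hy t ht.1, Matrix.mulVec_add, Matrix.mulVec_smul, Matrix.mulVec_smul, neg_smul]
  abel
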